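/- arXiv:1404.3057 — 2 statements merged into one kernel-verified Lean document; each statement's English description precedes it below -/
import Mathlib

section
/- With notation as in the paper (f_1,…,f_n a transcendence basis, each f_k for k > n satisfying an irreducible relation R_k(f_1,…,f_n,f_k)=0): if multiplication by f_1 and by each ∂_k R_k (n < k ≤ m) is injective on the module N', then the canonical surjection N' → N is an isomorphism of A-modules. -/
open MvPolynomial in
lemma linInd_D_of_transBasis {K Q σ : Type*} [Field K] [CharZero K] [Field Q] [Algebra K Q]
    (v : σ → Q) (hv : IsTranscendenceBasis K v) :
    LinearIndependent Q (fun i => KaehlerDifferential.D K Q (v i)) := by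
  let : Algebra (MvPolynomial σ K) Q := (aeval (R := K) v).toRingHom.toAlgebra
  have hmap : ∀ p : MvPolynomial σ K, algebraMap (MvPolynomial σ K) Q p = aeval v p := fun _ => rfl
  have : IsScalarTower K (MvPolynomial σ K) Q := .of_algebraMap_eq fun x => by
    rw [hmap]; simp
  have : FaithfulSMul (MvPolynomial σ K) Q :=
    (faithfulSMul_iff_algebraMap_injective _ _).2 hv.1
  have : Algebra.IsAlgebraic (Algebra.adjoin K (Set.range v)) Q := hv.isAlgebraic
  have : Algebra.IsAlgebraic (MvPolynomial σ K) Q :=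
    Algebra.IsAlgebraic.of_ringHom_of_comp_eq (S := Algebra.adjoin K (Set.range v)) (B := Q)
      (hv.1.aevalEquiv : MvPolynomial σ K ≃ₐ[K] _) (RingHom.id Q)
      hv.1.aevalEquiv.surjective Function.injective_id (by
        ext x <;> simp [hmap])
  let L := FractionRing (MvPolynomial σ K)
  let : Algebra L Q := FractionRing.liftAlgebra (MvPolynomial σ K) Q
  have : IsScalarTower (MvPolynomial σ K) L Q :=
    FractionRing.isScalarTower_liftAlgebra (MvPolynomial σ K) Q
  have : Algebra.IsAlgebraic L Q :=
    (IsFractionRing.comap_isAlgebraic_iff (A := MvPolynomial σ K)).1 inferInstance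
  have : CharZero L := charZero_of_injective_algebraMap (algebraMap K L).injective
  have : Algebra.FormallyEtale L Q := Algebra.FormallyEtale.of_isSeparable L Q
  have : Algebra.FormallyEtale (MvPolynomial σ K) L :=
    Algebra.FormallyEtale.of_isLocalization (nonZeroDivisors _)
  have : Algebra.FormallyEtale (MvPolynomial σ K) Q := Algebra.FormallyEtale.comp _ L _
  have hb := KaehlerDifferential.isBaseChange_of_formallyEtale K (MvPolynomial σ K) Q
  have := (hb.basis (KaehlerDifferential.mvPolynomialBasis K σ)).linearIndependent
  have heq : (fun i => KaehlerDifferential.D K Q (v i)) =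
      ⇑(hb.basis (KaehlerDifferential.mvPolynomialBasis K σ)) := by
    funext i
    rw [hb.basis_apply]
    simp [hmap]
  rw [heq]
  exact this

lemma linInd_D_of_algInd {K Q σ : Type*} [Field K] [CharZero K] [Field Q] [Algebra K Q]
    (v : σ → Q) (hv : AlgebraicIndependent K v) :
    LinearIndependent Q (fun i => KaehlerDifferential.D K Q (v i)) := by
  obtain ⟨t, ht, hb⟩ := exists_isTranscendenceBasis_superset (R := K) (s := Set.range v)
    hv.coe_range
  have := linInd_D_of_transBasis _ hb
  exact this.comp (fun i => (⟨v i, ht ⟨i, rfl⟩⟩ : t)) (fun i j h => hv.injective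
    (by simpa using h))

lemma core_injective {A Q N W : Type*} [CommRing A] [Field Q] (ι : A →+* Q)
    (hι : Function.Injective ι) [AddCommGroup N] [Module A N] [AddCommGroup W] [Module Q W]
    {m n : ℕ} (hnm : n ≤ m) (hm : 0 < m) (f : Fin m → A) (d : Fin m → ℕ) (P : Fin m → A)
    (g : Fin m → Fin m → N) (w : Fin m → W)
    (hspan : Submodule.span A (Set.range (fun q : Fin m × Fin m => g q.1 q.2)) = ⊤)
    (h1 : ∀ i j k, ((d k : A) * f k) • g i j =
      ((d j : A) * f j) • g i k + ((d i : A) * f i) • g k j)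
    (h2 : ∀ i j, g i j = - g j i)
    (hz : g ⟨0, hm⟩ ⟨0, hm⟩ = 0)
    (h3 : ∀ k : Fin m, n ≤ (k : ℕ) → P k • g k ⟨0, hm⟩ ∈
      Submodule.span A (Set.range (fun i : Fin n => g (Fin.castLE hnm i) ⟨0, hm⟩)))
    (hd : IsUnit (d ⟨0, hm⟩ : A)) (hf : f ⟨0, hm⟩ ≠ 0)
    (hfinj : Function.Injective (fun x : N => f ⟨0, hm⟩ • x))
    (hPinj : ∀ k : Fin m, n ≤ (k : ℕ) → Function.Injective (fun x : N => P k • x))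
    (φ : N →+ W) (hφ : ∀ (a : A) (x : N), φ (a • x) = ι a • φ x)
    (hφg : ∀ i j, φ (g i j) = (d j : Q) • (ι (f j) • w i) - (d i : Q) • (ι (f i) • w j))
    (hw : LinearIndependent Q (fun i : Fin n => w (Fin.castLE hnm i))) :
    Function.Injective φ := by
  classical
  set z : Fin m := ⟨0, hm⟩ with hzdef
  set T := Submodule.span A (Set.range (fun i : Fin n => g (Fin.castLE hnm i) z)) with hT
  set s : Finset (Fin m) := Finset.univ.filter (fun k => n ≤ (k : ℕ)) with hs
  set p : A := ∏ k ∈ s, P k with hp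
  have hpg : ∀ i, p • g i z ∈ T := by
    intro i
    by_cases hi : n ≤ (i : ℕ)
    · have : i ∈ s := by simp [hs, hi]
      rw [hp, ← Finset.mul_prod_erase s P this, mul_comm, mul_smul]
      exact T.smul_mem _ (h3 i hi)
    · exact T.smul_mem _ (Submodule.subset_span ⟨⟨i, by omega⟩, rfl⟩)
  have hmem : ∀ x : N, p • (((d z : A) * f z) • x) ∈ T := by
    intro x
    have hx : x ∈ Submodule.span A (Set.range (fun q : Fin m × Fin m => g q.1 q.2)) := by
      rw [hspan]; trivial
    induction hx using Submodule.span_induction with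
    | mem x h =>
      obtain ⟨⟨i, j⟩, rfl⟩ := h
      dsimp only
      rw [h1 i j z, h2 z j, smul_add, smul_neg, smul_neg, smul_comm p, smul_comm p]
      exact T.add_mem (T.smul_mem _ (hpg i)) (T.neg_mem (T.smul_mem _ (hpg j)))
    | zero => simp
    | add x y _ _ hx hy => rw [smul_add, smul_add]; exact T.add_mem hx hy
    | smul a x _ hx => rw [smul_comm _ a, smul_comm _ a]; exact T.smul_mem _ hx
  have hcan : ∀ y ∈ T, φ y = 0 → y = 0 := by
    intro y hy h0
    obtain ⟨c, rfl⟩ := (Submodule.mem_span_range_iff_exists_fun A).1 hy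
    refine Finset.sum_eq_zero fun i0 _ => ?_
    have hn : 0 < n := by have := i0.2; omega
    let z' : Fin n := ⟨0, hn⟩
    have hz' : Fin.castLE hnm z' = z := rfl
    by_cases hi : i0 = z'
    · rw [hi, hz', hz, smul_zero]
    have hdz : ι (d z : A) ≠ 0 := (hd.map ι).ne_zero
    have hfz : ι (f z) ≠ 0 := fun h => hf (hι (by rw [h, map_zero]))
    have key : ∑ i : Fin n, (ι (c i) * ((d z : Q) * ι (f z)) -
        (if i = z' then ∑ j : Fin n, ι (c j) * ((d (Fin.castLE hnm j) : Q) *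
          ι (f (Fin.castLE hnm j))) else 0)) • w (Fin.castLE hnm i) = 0 := by
      rw [map_sum] at h0
      rw [← h0]
      simp only [hφ, hφg, sub_smul, smul_sub, Finset.sum_sub_distrib, ite_smul, zero_smul,
        Finset.sum_ite_eq', Finset.mem_univ, if_true, hz', Finset.sum_smul, mul_smul]
    have := Fintype.linearIndependent_iff.1 hw _ key i0
    rw [if_neg hi, sub_zero] at this
    have hc : c i0 = 0 := by
      apply hι
      rw [map_zero]
      rw [map_natCast] at hdz
      rcases mul_eq_zero.1 this with h | h
      · exact h
      · exact absurd h (mul_ne_zero hdz hfz)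
    rw [hc, zero_smul]
  have hprod : ∀ t : Finset (Fin m), (∀ k ∈ t, n ≤ (k : ℕ)) → ∀ x : N,
      (∏ k ∈ t, P k) • x = 0 → x = 0 := by
    intro t
    induction t using Finset.induction_on with
    | empty => intro _ x hx; simpa using hx
    | insert k t hk ih =>
      intro ht x hx
      rw [Finset.prod_insert hk, mul_smul] at hx
      refine ih (fun j hj => ht j (Finset.mem_insert_of_mem hj)) x ?_
      exact hPinj k (ht k (Finset.mem_insert_self _ _)) (by simpa using hx)
  rw [injective_iff_map_eq_zero]
  intro x hx
  have h := hcan _ (hmem x) (by rw [hφ, hφ, hx, smul_zero, smul_zero])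
  have h' := hprod s (by simp [hs]) _ h
  rw [mul_smul] at h'
  have h'' : f z • x = 0 := hd.smul_eq_zero.1 h'
  exact hfinj (by simpa using h'')


open MvPolynomial in
/-- if multiplication by f₁ and by each ∂_k R_k is injective on N',
    then the canonical surjection N' → N is an isomorphism (i.e. injective). -/
theorem presented_module_iso_of_injective_smul
    {K A : Type*} [Field K] [CharZero K] [CommRing A] [IsDomain A] [Algebra K A]
    (𝒜 : ℕ → Submodule K A) [GradedAlgebra 𝒜]
    {m : ℕ} (hm : 0 < m) (f : Fin m → A) (d : Fin m → ℕ)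
    (hd : ∀ i, 0 < d i) (hhom : ∀ i, f i ∈ 𝒜 (d i)) (hf0 : ∀ i, f i ≠ 0)
    (hgen : Algebra.adjoin K (Set.range f) = ⊤)
    (n : ℕ) (hnm : n ≤ m)
    (hindep : AlgebraicIndependent K (fun i : Fin n => f (Fin.castLE hnm i)))
    (R : Fin m → MvPolynomial (Fin m) K)
    (hRvars : ∀ k : Fin m, n ≤ (k : ℕ) → ∀ i ∈ (R k).vars, (i : ℕ) < n ∨ i = k)
    (hRirr : ∀ k : Fin m, n ≤ (k : ℕ) → Irreducible (R k))
    (hRiso : ∀ k : Fin m, n ≤ (k : ℕ) → ∃ w : ℕ, ∀ v ∈ (R k).support, ∑ i, d i * v i = w)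
    (hR0 : ∀ k : Fin m, n ≤ (k : ℕ) → aeval f (R k) = 0) :
    letI Q := FractionRing A
    letI ι := algebraMap A (FractionRing A)
    letI D := KaehlerDifferential.D K (FractionRing A)
    letI : Module A (KaehlerDifferential K (FractionRing A)) :=
      Module.compHom _ (algebraMap A (FractionRing A))
    ∀ Rel : Submodule A ((Fin m × Fin m) →₀ A),
      Rel = Submodule.span A
        ({x | ∃ i j k : Fin m,
            x = Finsupp.single (i, j) ((d k : A) * f k)
              - Finsupp.single (i, k) ((d j : A) * f j)
              - Finsupp.single (k, j) ((d i : A) * f i)} ∪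
         {x | ∃ i j : Fin m, x = Finsupp.single (i, j) (1 : A) + Finsupp.single (j, i) (1 : A)} ∪
         {x | ∃ (S : MvPolynomial (Fin m) K) (μ : Fin m) (k : ℕ),
            (∀ v ∈ S.support, ∑ i, d i * v i = k) ∧ aeval f S = 0 ∧
            x = ∑ ν, Finsupp.single (ν, μ) (aeval f (pderiv ν S))}) →
      -- multiplication by f₁ is injective on N'
      Function.Injective
        (fun x : ((Fin m × Fin m) →₀ A) ⧸ Rel => f ⟨0, hm⟩ • x) →
      -- multiplication by each ∂_k R_k (n ≤ k) is injective on N'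
      (∀ k : Fin m, n ≤ (k : ℕ) →
        Function.Injective
          (fun x : ((Fin m × Fin m) →₀ A) ⧸ Rel => (aeval f (pderiv k (R k))) • x)) →
      ∀ φ : (((Fin m × Fin m) →₀ A) ⧸ Rel) →ₗ[A] KaehlerDifferential K (FractionRing A),
        (∀ i j : Fin m,
          φ (Submodule.Quotient.mk (Finsupp.single (i, j) (1 : A))) =
            (d j : Q) • (ι (f j) • D (ι (f i))) - (d i : Q) • (ι (f i) • D (ι (f j)))) →
        Function.Injective φ := by
  intro Rel hRel hfinj hPinj φ hφ
  have hunit : ∀ k : ℕ, 0 < k → IsUnit (k : A) := by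
    intro k hk
    have : IsUnit (algebraMap K A (k : K)) :=
      (IsUnit.mk0 (k : K) (by exact_mod_cast hk.ne')).map (algebraMap K A)
    simpa using this
  let g : Fin m → Fin m → (((Fin m × Fin m) →₀ A) ⧸ Rel) :=
    fun i j => Submodule.Quotient.mk (Finsupp.single (i, j) (1 : A))
  have hsingle : ∀ i j (a : A),
      (Submodule.Quotient.mk (Finsupp.single (i, j) a) : ((Fin m × Fin m) →₀ A) ⧸ Rel)
        = a • g i j := by
    intro i j a
    rw [← Submodule.Quotient.mk_smul, Finsupp.smul_single, smul_eq_mul, mul_one]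
  have h2 : ∀ i j, g i j = - g j i := by
    intro i j
    have hmem : Finsupp.single (i, j) (1 : A) + Finsupp.single (j, i) (1 : A) ∈ Rel := by
      rw [hRel]
      exact Submodule.subset_span (Or.inl (Or.inr ⟨i, j, rfl⟩))
    have := (Submodule.Quotient.mk_eq_zero Rel).2 hmem
    rw [Submodule.Quotient.mk_add] at this
    exact eq_neg_of_add_eq_zero_left this
  have h1 : ∀ i j k, ((d k : A) * f k) • g i j =
      ((d j : A) * f j) • g i k + ((d i : A) * f i) • g k j := by
    intro i j k
    have hmem : Finsupp.single (i, j) ((d k : A) * f k)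
              - Finsupp.single (i, k) ((d j : A) * f j)
              - Finsupp.single (k, j) ((d i : A) * f i) ∈ Rel := by
      rw [hRel]
      exact Submodule.subset_span (Or.inl (Or.inl ⟨i, j, k, rfl⟩))
    have := (Submodule.Quotient.mk_eq_zero Rel).2 hmem
    rw [Submodule.Quotient.mk_sub, Submodule.Quotient.mk_sub, hsingle, hsingle, hsingle,
      sub_sub, sub_eq_zero] at this
    exact this
  have hspan : Submodule.span A (Set.range (fun q : Fin m × Fin m => g q.1 q.2)) = ⊤ := by
    rw [eq_top_iff]
    intro x _
    obtain ⟨y, rfl⟩ := Submodule.Quotient.mk_surjective Rel x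
    induction y using Finsupp.induction_linear with
    | zero => rw [Submodule.Quotient.mk_zero]; exact Submodule.zero_mem _
    | add a b ha hb =>
      rw [Submodule.Quotient.mk_add]
      exact Submodule.add_mem _ (ha trivial) (hb trivial)
    | single q a =>
      obtain ⟨i, j⟩ := q
      rw [hsingle]
      exact Submodule.smul_mem _ _ (Submodule.subset_span ⟨(i, j), rfl⟩)
  have hz : g ⟨0, hm⟩ ⟨0, hm⟩ = 0 := by
    have h := h2 ⟨0, hm⟩ ⟨0, hm⟩
    have h' : ((2 : ℕ) : A) • g ⟨0, hm⟩ ⟨0, hm⟩ = 0 := by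
      rw [Nat.cast_smul_eq_nsmul, two_smul]
      exact add_eq_zero_iff_eq_neg.2 h
    exact (hunit 2 (by norm_num)).smul_eq_zero.1 h'
  have h3 : ∀ k : Fin m, n ≤ (k : ℕ) → aeval f (pderiv k (R k)) • g k ⟨0, hm⟩ ∈
      Submodule.span A (Set.range (fun i : Fin n => g (Fin.castLE hnm i) ⟨0, hm⟩)) := by
    intro k hk
    obtain ⟨wt, hwt⟩ := hRiso k hk
    have hmem : ∑ ν, Finsupp.single (ν, (⟨0, hm⟩ : Fin m)) (aeval f (pderiv ν (R k))) ∈ Rel := by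
      rw [hRel]
      exact Submodule.subset_span (Or.inr ⟨R k, ⟨0, hm⟩, wt, hwt, hR0 k hk, rfl⟩)
    have h0 := (Submodule.Quotient.mk_eq_zero Rel).2 hmem
    rw [← Submodule.mkQ_apply, map_sum] at h0
    simp only [Submodule.mkQ_apply, hsingle] at h0
    rw [← Finset.add_sum_erase _ _ (Finset.mem_univ k)] at h0
    rw [eq_neg_of_add_eq_zero_left h0]
    refine Submodule.neg_mem _ (Submodule.sum_mem _ fun ν hν => ?_)
    by_cases hlt : (ν : ℕ) < n
    · exact Submodule.smul_mem _ _ (Submodule.subset_span ⟨⟨ν, hlt⟩, rfl⟩)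
    · have : pderiv ν (R k) = 0 := by
        apply pderiv_eq_zero_of_notMem_vars
        intro hv
        rcases hRvars k hk ν hv with h | h
        · exact hlt h
        · exact (Finset.ne_of_mem_erase hν) h
      rw [this, map_zero, zero_smul]
      exact Submodule.zero_mem _
  have hιinj : Function.Injective (algebraMap A (FractionRing A)) :=
    IsFractionRing.injective A (FractionRing A)
  have hw : LinearIndependent (FractionRing A) (fun i : Fin n =>
      KaehlerDifferential.D K (FractionRing A)
        (algebraMap A (FractionRing A) (f (Fin.castLE hnm i)))) := by
    apply linInd_D_of_algInd
    exact hindep.map' (f := IsScalarTower.toAlgHom K A (FractionRing A)) hιinj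
  let inst : Module A (KaehlerDifferential K (FractionRing A)) :=
    Module.compHom _ (algebraMap A (FractionRing A))
  exact core_injective (algebraMap A (FractionRing A)) hιinj hnm hm f d
    (fun k => aeval f (pderiv k (R k))) g
    (fun i => KaehlerDifferential.D K (FractionRing A) (algebraMap A (FractionRing A) (f i)))
    hspan h1 h2 hz h3 (hunit _ (hd _)) (hf0 _) hfinj hPinj φ.toAddMonoidHom
    (fun a x => φ.map_smul a x) hφ hw
end

section
/- Let t_0,…,t_n be holomorphic functions on a domain D ⊆ ℂ^{n−1} with P(t_0(z),…,t_n(z)) = 0 identically for a homogeneous polynomial P. Let G_i(z) be (−1)^i times the maximal minor obtained by deleting the i-th column from the n×(n+1) matrix whose rows are (t_0,…,t_n) and its partial derivatives (∂_k t_0,…,∂_k t_n), 1 ≤ k ≤ n−1. Then for each z where (∂P)(t(z)) ≠ 0, there exists f(z) ∈ ℂ with G_i(z) = f(z)·(∂_i P)(t(z)) for all i, and f is holomorphic on that locus. -/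
open MeasureTheory Metric Set Filter Topology in
lemma aux_fderiv_bound {m : ℕ} {f : (Fin m → ℂ) → ℂ} {z : Fin m → ℂ} {r C : ℝ} (hr : 0 < r)
    (hf : ∀ x ∈ closedBall z r, DifferentiableAt ℂ f x)
    (hC : ∀ x ∈ closedBall z r, ‖f x‖ ≤ C) : ‖fderiv ℂ f z‖ ≤ C / r := by
  have hC0 : 0 ≤ C := (norm_nonneg _).trans (hC z (mem_closedBall_self hr.le))
  refine ContinuousLinearMap.opNorm_le_bound _ (by positivity) fun v => ?_
  rcases eq_or_ne v 0 with rfl | hv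
  · simp
  have hv' : 0 < ‖v‖ := norm_pos_iff.2 hv
  have hmem : ∀ ζ ∈ closedBall (0:ℂ) (r / ‖v‖), z + ζ • v ∈ closedBall z r := by
    intro ζ hζ
    simp only [mem_closedBall, dist_zero_right, dist_self_add_left, norm_smul] at hζ ⊢
    rwa [le_div_iff₀ hv'] at hζ
  have hd : HasDerivAt (fun ζ : ℂ => f (z + ζ • v)) (fderiv ℂ f z v) 0 := by
    have h1 : HasFDerivAt f (fderiv ℂ f z) (z + (0:ℂ) • v) := by
      simpa using (hf z (mem_closedBall_self hr.le)).hasFDerivAt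
    have h2 : HasDerivAt (fun ζ : ℂ => z + ζ • v) v 0 := by
      simpa using ((hasDerivAt_id (0:ℂ)).smul_const v).const_add z
    exact h1.comp_hasDerivAt (0:ℂ) h2
  have := Complex.norm_deriv_le_of_forall_mem_sphere_norm_le (c := 0) (R := r / ‖v‖) (C := C)
    (f := fun ζ : ℂ => f (z + ζ • v)) (by positivity) ?_ ?_
  · rw [hd.deriv] at this
    refine this.trans (le_of_eq ?_)
    field_simp
  · apply DifferentiableOn.diffContOnCl
    intro ζ hζ
    have h1 := hf _ (hmem ζ (closure_ball_subset_closedBall hζ))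
    have h2 : DifferentiableAt ℂ (fun ζ : ℂ => z + ζ • v) ζ := by fun_prop
    exact (DifferentiableAt.comp ζ h1 h2).differentiableWithinAt
  · intro ζ hζ
    exact hC _ (hmem ζ (sphere_subset_closedBall hζ))

open MeasureTheory Metric Set Filter Topology in
lemma aux_fderiv_diff {m : ℕ} {f : (Fin m → ℂ) → ℂ} {U : Set (Fin m → ℂ)} (hU : IsOpen U)
    (hf : DifferentiableOn ℂ f U) (v : Fin m → ℂ) {z : Fin m → ℂ} (hz : z ∈ U) :
    DifferentiableAt ℂ (fun x => fderiv ℂ f x v) z := by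
  obtain ⟨R, hR, hRU⟩ := nhds_basis_closedBall.mem_iff.1 (hU.mem_nhds hz)
  obtain ⟨C, hC⟩ := (isCompact_closedBall z R).exists_bound_of_continuousOn
    (hf.continuousOn.mono hRU)
  have hfd : ∀ x ∈ closedBall z R, DifferentiableAt ℂ f x := fun x hx =>
    hf.differentiableAt (hU.mem_nhds (hRU hx))
  set r := R / 3 with hrdef
  have hr : 0 < r := by positivity
  set δ := r / (1 + ‖v‖) with hδdef
  have hδ : 0 < δ := by positivity
  have hmem : ∀ x ∈ ball z r, ∀ ζ ∈ closedBall (0:ℂ) δ, x + ζ • v ∈ closedBall z (2 * r) := by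
    intro x hx ζ hζ
    have h1 : ‖ζ • v‖ ≤ r := by
      rw [norm_smul]
      rw [mem_closedBall, dist_zero_right] at hζ
      calc ‖ζ‖ * ‖v‖ ≤ δ * (1 + ‖v‖) := by gcongr; linarith
        _ = r := by rw [hδdef]; field_simp
    rw [mem_ball, dist_eq_norm] at hx
    rw [mem_closedBall, dist_eq_norm]
    calc ‖x + ζ • v - z‖ = ‖(x - z) + ζ • v‖ := by congr 1; abel
      _ ≤ ‖x - z‖ + ‖ζ • v‖ := norm_add_le _ _
      _ ≤ 2 * r := by linarith
  have hsub : closedBall z (2 * r) ⊆ closedBall z R := closedBall_subset_closedBall (by linarith)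
  have hbd : ∀ y ∈ closedBall z (2 * r), ‖fderiv ℂ f y‖ ≤ C / r := by
    intro y hy
    have : closedBall y r ⊆ closedBall z R := by
      apply closedBall_subset_closedBall'
      rw [mem_closedBall] at hy
      linarith
    exact aux_fderiv_bound hr (fun x hx => hfd x (this hx)) (fun x hx => hC x (this hx))
  have hcm : ∀ θ, circleMap 0 δ θ ∈ closedBall (0:ℂ) δ := fun θ =>
    circleMap_mem_closedBall 0 hδ.le θ
  -- kernel
  set c : ℝ → ℂ := fun θ => (2 * Real.pi * Complex.I)⁻¹ *
    (deriv (circleMap 0 δ) θ * ((circleMap 0 δ θ) ^ 2)⁻¹) with hcdef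
  have hcc : Continuous c := by
    have h0 : ∀ θ, (circleMap 0 δ θ) ^ 2 ≠ 0 := fun θ =>
      pow_ne_zero _ (by simp [circleMap, hδ.ne'])
    have h1 : Continuous (circleMap 0 δ) := continuous_circleMap 0 δ
    simp only [hcdef, deriv_circleMap]
    exact continuous_const.mul ((h1.mul continuous_const).mul ((h1.pow 2).inv₀ h0))
  have hline : ∀ x : Fin m → ℂ, Continuous fun θ : ℝ => x + circleMap 0 δ θ • v := fun x =>
    continuous_const.add ((continuous_circleMap 0 δ).smul continuous_const)
  have hFc : ∀ x ∈ ball z r, Continuous fun θ : ℝ => c θ * f (x + circleMap 0 δ θ • v) := by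
    intro x hx
    refine hcc.mul (continuous_iff_continuousAt.2 fun θ => ?_)
    exact ContinuousAt.comp (f := fun θ : ℝ => x + circleMap 0 δ θ • v)
      (hfd _ (hsub (hmem x hx _ (hcm θ)))).continuousAt (hline x).continuousAt
  have hrep : ∀ x ∈ ball z r, fderiv ℂ f x v =
      ∫ θ in (0:ℝ)..(2 * Real.pi), c θ * f (x + circleMap 0 δ θ • v) := by
    intro x hx
    have hx' : x ∈ closedBall z R :=
      hsub (by simpa using hmem x hx 0 (mem_closedBall_self hδ.le))
    have hd : HasDerivAt (fun ζ : ℂ => f (x + ζ • v)) (fderiv ℂ f x v) 0 := by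
      have h1 : HasFDerivAt f (fderiv ℂ f x) (x + (0:ℂ) • v) := by
        simpa using (hfd x hx').hasFDerivAt
      have h2 : HasDerivAt (fun ζ : ℂ => x + ζ • v) v 0 := by
        simpa using ((hasDerivAt_id (0:ℂ)).smul_const v).const_add x
      exact h1.comp_hasDerivAt (0:ℂ) h2
    have hdc : DiffContOnCl ℂ (fun ζ : ℂ => f (x + ζ • v)) (ball 0 δ) := by
      apply DifferentiableOn.diffContOnCl
      intro ζ hζ
      have h1 := hfd _ (hsub (hmem x hx ζ (closure_ball_subset_closedBall hζ)))
      have h2 : DifferentiableAt ℂ (fun ζ : ℂ => x + ζ • v) ζ := by fun_prop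
      exact (DifferentiableAt.comp ζ h1 h2).differentiableWithinAt
    have key := hdc.deriv_eq_smul_circleIntegral hδ
    rw [hd.deriv] at key
    have h2 : (2 * Real.pi * Complex.I : ℂ) ≠ 0 := Complex.two_pi_I_ne_zero
    rw [smul_eq_mul] at key
    have h3 : fderiv ℂ f x v = (2 * Real.pi * Complex.I : ℂ)⁻¹ *
      ∮ ζ in C(0, δ), (1 / (ζ - 0) ^ 2) • f (x + ζ • v) := by
      rw [key, inv_mul_cancel_left₀ h2]
    rw [h3, circleIntegral, ← intervalIntegral.integral_const_mul]
    congr 1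
    funext θ
    simp only [hcdef, smul_eq_mul, sub_zero, one_div]
    ring
  have hmeas : AEStronglyMeasurable
      (fun θ : ℝ => c θ • fderiv ℂ f (z + circleMap 0 δ θ • v))
      (volume.restrict (Set.uIoc (0:ℝ) (2 * Real.pi))) := by
    have := (measurable_fderiv ℂ f).comp (hline z).measurable
    exact (hcc.measurable.smul this).aestronglyMeasurable
  have main := (intervalIntegral.hasFDerivAt_integral_of_dominated_of_fderiv_le
    (μ := volume) (𝕜 := ℂ) (a := 0) (b := 2 * Real.pi) (x₀ := z) (s := ball z r)
    (F := fun x θ => c θ * f (x + circleMap 0 δ θ • v))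
    (F' := fun x θ => c θ • fderiv ℂ f (x + circleMap 0 δ θ • v))
    (bound := fun θ => ‖c θ‖ * (C / r)) (ball_mem_nhds z hr)
    (by
      filter_upwards [ball_mem_nhds z hr] with x hx
      exact (hFc x hx).aestronglyMeasurable)
    ((hFc z (mem_ball_self hr)).intervalIntegrable _ _)
    hmeas
    (by
      refine Eventually.of_forall fun θ _ x hx => ?_
      rw [norm_smul]
      gcongr
      exact hbd _ (hmem x hx _ (hcm θ)))
    ((hcc.norm.mul continuous_const).intervalIntegrable _ _)
    (by
      refine Eventually.of_forall fun θ _ x hx => ?_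
      have h1 := (hfd _ (hsub (hmem x hx _ (hcm θ)))).hasFDerivAt
      have h2 : HasFDerivAt (fun x : Fin m → ℂ => x + circleMap 0 δ θ • v)
        (ContinuousLinearMap.id ℂ (Fin m → ℂ)) x := (hasFDerivAt_id x).add_const _
      exact (HasFDerivAt.comp x h1 h2).const_mul (c θ)))
  refine (main.congr_of_eventuallyEq ?_).differentiableAt
  filter_upwards [ball_mem_nhds z hr] with x hx
  exact hrep x hx

open Matrix in
lemma aux_minors {n : ℕ} (M : Matrix (Fin n) (Fin (n+1)) ℂ) (g : Fin (n+1) → ℂ)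
    (h : M *ᵥ g = 0) (i j : Fin (n+1)) :
    ((-1 : ℂ) ^ (i : ℕ) * det (M.submatrix id i.succAbove)) * g j =
      ((-1 : ℂ) ^ (j : ℕ) * det (M.submatrix id j.succAbove)) * g i := by
  let A : Matrix (Fin (n+1)) (Fin (n+1)) ℂ := Matrix.of (Fin.cons (Pi.single i 1) M)
  have hA0 : A 0 = Pi.single i 1 := rfl
  have hAs : ∀ a : Fin n, A a.succ = M a := fun _ => rfl
  have hadj : ∀ l, A.adjugate l 0 = (-1 : ℂ) ^ (l : ℕ) * det (M.submatrix id l.succAbove) := by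
    intro l
    rw [adjugate_fin_succ_eq_det_submatrix]
    simp only [Fin.val_zero, zero_add]
    congr 2
  have hdet : A.det = (-1 : ℂ) ^ (i : ℕ) * det (M.submatrix id i.succAbove) := by
    rw [det_succ_row_zero, Finset.sum_eq_single i]
    · have : A 0 i = 1 := by simp [hA0]
      rw [this, mul_one]; congr 2
    · intro b _ hb
      have : A 0 b = 0 := by simp [hA0, hb]
      rw [this]; ring
    · simp
  have hAg : A *ᵥ g = Pi.single 0 (g i) := by
    ext a
    refine Fin.cases ?_ (fun a => ?_) a
    · simp [hA0, mulVec]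
    · simpa [hAs, mulVec] using congrFun h a
  have := congrFun (congrArg (fun x => A.adjugate *ᵥ x) hAg) j
  simp only [mulVec_mulVec, adjugate_mul, smul_mulVec, one_mulVec, Pi.smul_apply, smul_eq_mul,
    mulVec_single] at this
  simp only [hdet] at this
  rw [this]
  simp [hadj]

open MvPolynomial in
lemma aux_hasFDeriv {n : ℕ} (P : MvPolynomial (Fin n) ℂ) (x : Fin n → ℂ) :
    HasFDerivAt (fun y => eval y P)
      (∑ i, eval x (pderiv i P) • ContinuousLinearMap.proj (R := ℂ) (φ := fun _ : Fin n => ℂ) i) x := by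
  induction P using MvPolynomial.induction_on with
  | C a =>
    simp only [eval_C]
    refine (hasFDerivAt_const a x).congr_fderiv ?_
    ext v
    simp
  | add p q hp hq =>
    simp only [map_add]
    refine (hp.fun_add hq).congr_fderiv ?_
    ext v
    simp [add_mul, Finset.sum_add_distrib]
  | mul_X p j hp =>
    have hj : HasFDerivAt (fun y : Fin n → ℂ => y j)
      (ContinuousLinearMap.proj (R := ℂ) (φ := fun _ : Fin n => ℂ) j) x := hasFDerivAt_apply j x
    simp only [map_mul, eval_X]
    refine (hp.fun_mul hj).congr_fderiv ?_
    ext v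
    have h1 : ∀ i : Fin n, eval x (pderiv i (p * X j)) =
        eval x p * (if i = j then 1 else 0) + x j * eval x (pderiv i p) := by
      intro i
      rw [Derivation.leibniz, pderiv_X]
      by_cases h : i = j
      · subst h; simp
      · simp [h, Pi.single_apply, Ne.symm h]
    simp_rw [h1]
    simp [Finset.sum_add_distrib, add_mul, Finset.mul_sum, mul_assoc]

open MvPolynomial in
lemma aux_euler {n : ℕ} (P : MvPolynomial (Fin n) ℂ) (k : ℕ) (h : P.IsHomogeneous k)
    (x : Fin n → ℂ) : ∑ i, x i * eval x (pderiv i P) = k * eval x P := by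
  have := congrArg (eval x) h.sum_X_mul_pderiv
  simpa using this


open MvPolynomial in
/-- for a holomorphic map `t : D → ℂ^{m+2}` into the affine cone of the
regular locus of the hypersurface `P = 0` in `ℙ^{m+1}(ℂ)`, the signed maximal minors
`G_i` of the matrix with rows `t, ∂₁t, …, ∂_m t` are proportional to the gradient of `P`
along `t`, with a holomorphic factor `f`. -/
theorem minors_proportional_to_gradient
    {m : ℕ} (P : MvPolynomial (Fin (m + 2)) ℂ) (hirr : Irreducible P)
    (k : ℕ) (hhom : P.IsHomogeneous k)
    (D : Set (Fin m → ℂ)) (hD : IsOpen D)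
    (t : (Fin m → ℂ) → Fin (m + 2) → ℂ) (ht : DifferentiableOn ℂ t D)
    (htne : ∀ z ∈ D, t z ≠ 0)
    (hP0 : ∀ z ∈ D, eval (t z) P = 0)
    (hreg : ∀ z ∈ D, ∃ i, eval (t z) (pderiv i P) ≠ 0) :
    ∃ f : (Fin m → ℂ) → ℂ, DifferentiableOn ℂ f D ∧
      ∀ z ∈ D, ∀ i : Fin (m + 2),
        (-1 : ℂ) ^ (i : ℕ) *
          Matrix.det (Matrix.of fun (r : Fin (m + 1)) (c : Fin (m + 1)) =>
            Fin.cases (t z (i.succAbove c))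
              (fun kk : Fin m =>
                fderiv ℂ (fun w => t w (i.succAbove c)) z (Pi.single kk 1)) r)
          = f z * eval (t z) (pderiv i P) := by
  classical
  set g : (Fin m → ℂ) → Fin (m + 2) → ℂ := fun z i => eval (t z) (pderiv i P) with hg
  set M : (Fin m → ℂ) → Matrix (Fin (m + 1)) (Fin (m + 2)) ℂ := fun z =>
    Matrix.of fun r c => Fin.cases (t z c)
      (fun kk : Fin m => fderiv ℂ (fun w => t w c) z (Pi.single kk 1)) r with hM
  set G : (Fin m → ℂ) → Fin (m + 2) → ℂ := fun z i =>
    (-1 : ℂ) ^ (i : ℕ) * Matrix.det ((M z).submatrix id i.succAbove) with hG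
  have htd : ∀ z ∈ D, DifferentiableAt ℂ t z := fun z hz => ht.differentiableAt (hD.mem_nhds hz)
  have htc : ∀ c, DifferentiableOn ℂ (fun w => t w c) D := fun c =>
    differentiableOn_pi.1 ht c
  have hMd : ∀ z ∈ D, ∀ r c, DifferentiableAt ℂ (fun w => M w r c) z := by
    intro z hz r c
    refine Fin.cases ?_ (fun kk => ?_) r
    · exact (htc c).differentiableAt (hD.mem_nhds hz)
    · exact aux_fderiv_diff hD (htc c) _ hz
  have hGd : ∀ z ∈ D, ∀ i, DifferentiableAt ℂ (fun w => G w i) z := by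
    intro z hz i
    simp only [hG, Matrix.det_apply, Matrix.submatrix_apply, id]
    refine DifferentiableAt.const_mul (DifferentiableAt.fun_sum fun σ _ => ?_) _
    have hp : DifferentiableAt ℂ (fun y => ∏ a, M y (σ a) (i.succAbove a)) z :=
      (HasFDerivAt.finsetProd (u := Finset.univ)
        fun a _ => (hMd z hz (σ a) (i.succAbove a)).hasFDerivAt).differentiableAt
    rw [show (fun y => Equiv.Perm.sign σ • ∏ a, M y (σ a) (i.succAbove a)) =
      fun y => ((Equiv.Perm.sign σ : ℤ) : ℂ) * ∏ a, M y (σ a) (i.succAbove a) by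
        funext y; simp [Units.smul_def]]
    exact hp.const_mul _
  have hgd : ∀ z ∈ D, ∀ i, DifferentiableAt ℂ (fun w => g w i) z := by
    intro z hz i
    exact DifferentiableAt.comp (g := fun y => eval y (pderiv i P)) z (aux_hasFDeriv (pderiv i P) (t z)).differentiableAt (htd z hz)
  have hker : ∀ z ∈ D, (M z).mulVec (g z) = 0 := by
    intro z hz
    ext r
    refine Fin.cases ?_ (fun kk => ?_) r
    · have := aux_euler P k hhom (t z)
      rw [hP0 z hz, mul_zero] at this
      exact this
    · have h1 := (aux_hasFDeriv P (t z)).comp z (htd z hz).hasFDerivAt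
      have h2 : HasFDerivAt ((fun y => eval y P) ∘ t) (0 : (Fin m → ℂ) →L[ℂ] ℂ) z := by
        refine (hasFDerivAt_const (0:ℂ) z).congr_of_eventuallyEq ?_
        filter_upwards [hD.mem_nhds hz] with w hw
        exact hP0 w hw
      have h3 := congrArg (fun L => L (Pi.single kk 1)) (h1.unique h2)
      have h4 : ∀ c, fderiv ℂ (fun w => t w c) z (Pi.single kk 1)
          = fderiv ℂ t z (Pi.single kk 1) c := by
        intro c
        have := (hasFDerivAt_pi'.1 (htd z hz).hasFDerivAt c).fderiv
        rw [this]; rfl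
      simp at h3
      simp only [hM, Matrix.mulVec, dotProduct, Matrix.of_apply, Fin.cases_succ, h4, Pi.zero_apply]
      rw [← h3]
      exact Finset.sum_congr rfl fun _ _ => mul_comm _ _
  have hprop : ∀ z ∈ D, ∀ i j, G z i * g z j = G z j * g z i := fun z hz i j =>
    aux_minors (M z) (g z) (hker z hz) i j
  choose! I hI using hreg
  refine ⟨fun z => G z (I z) / g z (I z), ?_, ?_⟩
  · intro z hz
    apply DifferentiableAt.differentiableWithinAt
    have h1 : DifferentiableAt ℂ (fun w => G w (I z) / g w (I z)) z := by
      simp only [div_eq_mul_inv]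
      exact (hGd z hz (I z)).fun_mul ((hgd z hz (I z)).fun_inv (hI z hz))
    refine h1.congr_of_eventuallyEq ?_
    filter_upwards [hD.mem_nhds hz, (hgd z hz (I z)).continuousAt.eventually_ne (hI z hz)]
      with w hw hne
    have := hI w hw
    rw [div_eq_div_iff this hne]
    exact hprop w hw _ _
  · intro z hz i
    have h2 := hI z hz
    change G z i = G z (I z) / g z (I z) * g z i
    rw [div_mul_eq_mul_div, eq_div_iff h2]
    exact hprop z hz _ _
end
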